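/- arXiv:1702.00155 — 3 statements merged into one kernel-verified Lean document; each statement's English description precedes it below -/
import Mathlib

section
/- Let X, Y be positive integers, B ∈ ℝ^{X×Y} and M̂ ∈ ℝ^{Y×Y} be fixed matrices, and let S ⊆ ℝ^X be a set such that every vector in S has strictly positive entries. Define the feasible sets F₁ = {(π, P) ∈ ℝ^X × ℝ^{X×X} : P ≥ 0, P𝟙 = 𝟙, π ≥ 0, 𝟙ᵀπ = 1, π ∈ S, π = Pᵀπ} and F₂ = {A ∈ ℝ^{X×X} : A ≥ 0, 𝟙ᵀA𝟙 = 1, A𝟙 ∈ S, A𝟙 = Aᵀ𝟙}. Then the map A ↦ (A𝟙, diag(A𝟙)⁻¹A) is a bijection from F₂ onto F₁ with inverse (π, P) ↦ diag(π)P, and it preserves the cost, i.e., for every A ∈ F₂, with (π, P) = (A𝟙, diag(A𝟙)⁻¹A) one has ‖M̂ − Bᵀ diag(π) P B‖_F² = ‖M̂ − Bᵀ A B‖_F². Consequently, A* minimizes ‖M̂ − BᵀAB‖_F² over F₂ if and only if (A*𝟙, diag(A*𝟙)⁻¹A*) minimizes ‖M̂ − Bᵀdiag(π)PB‖_F² over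 F₁, and the two optimal values coincide. -/
open Matrix BigOperators

theorem Matrix.inv_diagonal_of_ne_zero {n K : Type*} [Fintype n] [DecidableEq n] [Field K]
    {v : n → K} (hv : ∀ i, v i ≠ 0) : (diagonal v)⁻¹ = diagonal fun i => (v i)⁻¹ := by
  refine Matrix.inv_eq_left_inv ?_
  rw [diagonal_mul_diagonal, ← diagonal_one]
  exact congrArg diagonal (funext fun i => inv_mul_cancel₀ (hv i))

theorem Matrix.diagonal_mul_mulVec_one {n K : Type*} [Fintype n] [DecidableEq n] [CommSemiring K]
    {v : n → K} {P : Matrix n n K} (hP : P *ᵥ (fun _ => 1) = fun _ => 1) :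
    (diagonal v * P) *ᵥ (fun _ => 1) = v := by
  rw [← mulVec_mulVec, hP]
  ext i
  simp [mulVec_diagonal]

theorem Matrix.transpose_diagonal_mul_mulVec_one {n K : Type*} [Fintype n] [DecidableEq n]
    [CommSemiring K] (v : n → K) (P : Matrix n n K) :
    (diagonal v * P)ᵀ *ᵥ (fun _ => 1) = Pᵀ *ᵥ v := by
  rw [transpose_mul, diagonal_transpose, ← mulVec_mulVec]
  congr 1
  ext i
  simp [mulVec_diagonal]

/-- The nonconvex moment-matching problem over pairs (π, P) and the convex
problem over A = diag(π)P are equivalent: the map A ↦ (A𝟙, diag(A𝟙)⁻¹A) is a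
cost-preserving bijection between the feasible sets, minimizers correspond, and the
optimal values coincide. -/
theorem stmt_0 (X Y : ℕ) (hX : 0 < X) (hY : 0 < Y)
    (B : Matrix (Fin X) (Fin Y) ℝ) (Mhat : Matrix (Fin Y) (Fin Y) ℝ)
    (S : Set (Fin X → ℝ)) (hS : ∀ v ∈ S, ∀ i, 0 < v i) :
    let one : Fin X → ℝ := fun _ => 1
    let F1 : Set ((Fin X → ℝ) × Matrix (Fin X) (Fin X) ℝ) :=
      {p | (∀ i j, 0 ≤ p.2 i j) ∧ p.2.mulVec one = one ∧
           (∀ i, 0 ≤ p.1 i) ∧ (∑ i, p.1 i) = 1 ∧ p.1 ∈ S ∧ p.2ᵀ.mulVec p.1 = p.1}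
    let F2 : Set (Matrix (Fin X) (Fin X) ℝ) :=
      {A | (∀ i j, 0 ≤ A i j) ∧ (∑ i, ∑ j, A i j) = 1 ∧
           A.mulVec one ∈ S ∧ A.mulVec one = Aᵀ.mulVec one}
    let φ : Matrix (Fin X) (Fin X) ℝ → (Fin X → ℝ) × Matrix (Fin X) (Fin X) ℝ :=
      fun A => (A.mulVec one, (Matrix.diagonal (A.mulVec one))⁻¹ * A)
    let ψ : (Fin X → ℝ) × Matrix (Fin X) (Fin X) ℝ → Matrix (Fin X) (Fin X) ℝ :=
      fun p => Matrix.diagonal p.1 * p.2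
    let cost1 : (Fin X → ℝ) × Matrix (Fin X) (Fin X) ℝ → ℝ :=
      fun p => ∑ i, ∑ j, (Mhat i j - (Bᵀ * Matrix.diagonal p.1 * p.2 * B) i j) ^ 2
    let cost2 : Matrix (Fin X) (Fin X) ℝ → ℝ :=
      fun A => ∑ i, ∑ j, (Mhat i j - (Bᵀ * A * B) i j) ^ 2
    (∀ A ∈ F2, φ A ∈ F1) ∧
    (∀ p ∈ F1, ψ p ∈ F2) ∧
    (∀ A ∈ F2, ψ (φ A) = A) ∧
    (∀ p ∈ F1, φ (ψ p) = p) ∧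
    (∀ A ∈ F2, cost1 (φ A) = cost2 A) ∧
    (∀ Astar ∈ F2,
      ((∀ A ∈ F2, cost2 Astar ≤ cost2 A) ↔ (∀ p ∈ F1, cost1 (φ Astar) ≤ cost1 p))) ∧
    sInf (cost2 '' F2) = sInf (cost1 '' F1) := by
  intro one F1 F2 φ ψ cost1 cost2
  have sum_eq : ∀ A : Matrix (Fin X) (Fin X) ℝ, ∑ i, (A *ᵥ one) i = ∑ i, ∑ j, A i j := by
    intro A
    simp [one, mulVec, dotProduct]
  have hψφ : ∀ A ∈ F2, ψ (φ A) = A := by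
    rintro A ⟨-, -, hAS, -⟩
    have hv : ∀ i, (A *ᵥ one) i ≠ 0 := fun i => (hS _ hAS i).ne'
    change diagonal (A *ᵥ one) * ((diagonal (A *ᵥ one))⁻¹ * A) = A
    rw [← Matrix.mul_assoc, Matrix.mul_nonsing_inv, Matrix.one_mul]
    rw [det_diagonal]
    exact (Finset.prod_ne_zero_iff.2 fun i _ => hv i).isUnit
  have hφψ : ∀ p ∈ F1, φ (ψ p) = p := by
    rintro ⟨v, P⟩ ⟨-, hP, -, -, hvS, -⟩
    have hv : ∀ i, v i ≠ 0 := fun i => (hS _ hvS i).ne'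
    have h1 : (diagonal v * P) *ᵥ one = v := Matrix.diagonal_mul_mulVec_one hP
    change ((diagonal v * P) *ᵥ one,
      (diagonal ((diagonal v * P) *ᵥ one))⁻¹ * (diagonal v * P)) = (v, P)
    rw [h1, ← Matrix.mul_assoc, Matrix.nonsing_inv_mul, Matrix.one_mul]
    rw [det_diagonal]
    exact (Finset.prod_ne_zero_iff.2 fun i _ => hv i).isUnit
  have hφ : ∀ A ∈ F2, φ A ∈ F1 := by
    intro A hA
    have hA' : diagonal (A *ᵥ one) * ((diagonal (A *ᵥ one))⁻¹ * A) = A := hψφ A hA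
    obtain ⟨hA0, hA1, hAS, hAT⟩ := hA
    have hv := hS _ hAS
    refine ⟨fun i j => ?_, ?_, fun i => (hv i).le, (sum_eq A).trans hA1, hAS, ?_⟩
    · change 0 ≤ ((diagonal (A *ᵥ one))⁻¹ * A) i j
      rw [Matrix.inv_diagonal_of_ne_zero fun i => (hv i).ne', diagonal_mul]
      exact mul_nonneg (inv_nonneg.2 (hv i).le) (hA0 i j)
    · change ((diagonal (A *ᵥ one))⁻¹ * A) *ᵥ one = one
      rw [← mulVec_mulVec, Matrix.inv_diagonal_of_ne_zero fun i => (hv i).ne']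
      ext i
      rw [mulVec_diagonal]
      exact inv_mul_cancel₀ (hv i).ne'
    · change ((diagonal (A *ᵥ one))⁻¹ * A)ᵀ *ᵥ (A *ᵥ one) = A *ᵥ one
      rw [← Matrix.transpose_diagonal_mul_mulVec_one, hA']
      exact hAT.symm
  have hψ : ∀ p ∈ F1, ψ p ∈ F2 := by
    rintro ⟨v, P⟩ ⟨hP0, hP1, hv0, hv1, hvS, hvT⟩
    have h1 : (diagonal v * P) *ᵥ one = v := Matrix.diagonal_mul_mulVec_one hP1
    refine ⟨fun i j => ?_, ?_, ?_, ?_⟩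
    · change 0 ≤ (diagonal v * P) i j
      rw [diagonal_mul]
      exact mul_nonneg (hv0 i) (hP0 i j)
    · change ∑ i, ∑ j, (diagonal v * P) i j = 1
      rw [← sum_eq, h1]
      exact hv1
    · change (diagonal v * P) *ᵥ one ∈ S
      rwa [h1]
    · change (diagonal v * P) *ᵥ one = (diagonal v * P)ᵀ *ᵥ one
      rw [h1, Matrix.transpose_diagonal_mul_mulVec_one]
      exact hvT.symm
  have hcostψ : ∀ p, cost1 p = cost2 (ψ p) := by
    intro p
    simp only [cost1, cost2, ψ, Matrix.mul_assoc]
  have hcost : ∀ A ∈ F2, cost1 (φ A) = cost2 A := by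
    intro A hA
    rw [hcostψ, hψφ A hA]
  refine ⟨hφ, hψ, hψφ, hφψ, hcost, fun Astar hAstar => ⟨fun h p hp => ?_, fun h A hA => ?_⟩, ?_⟩
  · rw [hcost Astar hAstar, hcostψ p]
    exact h _ (hψ p hp)
  · rw [← hcost Astar hAstar, ← hcost A hA]
    exact h _ (hφ A hA)
  · congr 1
    ext c
    constructor
    · rintro ⟨A, hA, rfl⟩
      exact ⟨φ A, hφ A hA, hcost A hA⟩
    · rintro ⟨p, hp, rfl⟩
      exact ⟨ψ p, hψ p hp, (hcostψ p).symm⟩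
end

section
/- Let X ≤ Y be positive integers, let B ∈ ℝ^{X×Y} be a matrix of rank X (full row rank), and let M ∈ ℝ^{Y×Y} be an arbitrary matrix. Then the function f : ℝ^{X×X} → ℝ defined by f(A) = ‖M − Bᵀ A B‖_F² is strictly convex. -/
open Matrix BigOperators

/-- A real matrix of full row rank has a right inverse. -/
theorem Matrix.exists_mul_eq_one_of_rank_eq {m n : Type*} [Fintype m] [Fintype n]
    [DecidableEq m] (B : Matrix m n ℝ) (hB : B.rank = Fintype.card m) :
    ∃ C : Matrix n m ℝ, B * C = 1 := by
  have hsurj : Function.Surjective B.mulVec := by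
    have htop : LinearMap.range B.mulVecLin = ⊤ := by
      apply Submodule.eq_top_of_finrank_eq
      rw [Module.finrank_fintype_fun_eq_card, ← hB, Matrix.rank]
    exact LinearMap.range_eq_top.mp htop
  exact Matrix.mulVec_surjective_iff_exists_right_inverse.mp hsurj

/-- Congruence by a matrix of full row rank is injective. -/
theorem Matrix.transpose_mul_mul_injective {m n : Type*} [Fintype m] [Fintype n]
    [DecidableEq m] {B : Matrix m n ℝ} (hB : B.rank = Fintype.card m) :
    Function.Injective fun A : Matrix m m ℝ => Bᵀ * A * B := by
  obtain ⟨C, hC⟩ := B.exists_mul_eq_one_of_rank_eq hB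
  have hCt : Cᵀ * Bᵀ = 1 := by rw [← Matrix.transpose_mul, hC, Matrix.transpose_one]
  have key (A : Matrix m m ℝ) : Cᵀ * (Bᵀ * A * B) * C = A := by
    rw [← Matrix.mul_assoc, ← Matrix.mul_assoc, hCt, Matrix.one_mul, Matrix.mul_assoc, hC,
      Matrix.mul_one]
  intro A A' h
  dsimp only at h
  rw [← key A, h, key A']

/-- If B has full row rank X, then A ↦ ‖M − BᵀAB‖_F² is strictly convex. -/
theorem stmt_5 (X Y : ℕ) (hX : 0 < X) (hXY : X ≤ Y)
    (B : Matrix (Fin X) (Fin Y) ℝ) (hB : B.rank = X)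
    (M : Matrix (Fin Y) (Fin Y) ℝ) :
    ∀ A A' : Matrix (Fin X) (Fin X) ℝ, A ≠ A' → ∀ t : ℝ, 0 < t → t < 1 →
      (∑ i, ∑ j, (M i j - (Bᵀ * (t • A + (1 - t) • A') * B) i j) ^ 2) <
        t * (∑ i, ∑ j, (M i j - (Bᵀ * A * B) i j) ^ 2) +
          (1 - t) * (∑ i, ∑ j, (M i j - (Bᵀ * A' * B) i j) ^ 2) := by
  intro A A' hA t ht ht1
  have hne : Bᵀ * A * B ≠ Bᵀ * A' * B :=
    (Matrix.transpose_mul_mul_injective (by simpa using hB)).ne hA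
  have hlin : Bᵀ * (t • A + (1 - t) • A') * B =
      t • (Bᵀ * A * B) + (1 - t) • (Bᵀ * A' * B) := by
    simp only [Matrix.mul_add, Matrix.add_mul, Matrix.mul_smul, Matrix.smul_mul]
  rw [hlin]
  generalize Bᵀ * A * B = P at hne ⊢
  generalize Bᵀ * A' * B = Q at hne ⊢
  obtain ⟨i₀, j₀, hij⟩ : ∃ i j, P i j ≠ Q i j := by
    by_contra! h
    exact hne (Matrix.ext h)
  have hgap (m p q : ℝ) : t * (m - p) ^ 2 + (1 - t) * (m - q) ^ 2 =
      (m - (t * p + (1 - t) * q)) ^ 2 + t * (1 - t) * (p - q) ^ 2 := by ring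
  have ht' : 0 < t * (1 - t) := mul_pos ht (sub_pos.mpr ht1)
  have hpos : 0 < ∑ i, ∑ j, t * (1 - t) * (P i j - Q i j) ^ 2 := by
    have hnn (i j) : 0 ≤ t * (1 - t) * (P i j - Q i j) ^ 2 := mul_nonneg ht'.le (sq_nonneg _)
    refine Finset.sum_pos' (fun i _ => Finset.sum_nonneg fun j _ => hnn i j)
      ⟨i₀, Finset.mem_univ _, Finset.sum_pos' (fun j _ => hnn i₀ j) ⟨j₀, Finset.mem_univ _, ?_⟩⟩
    exact mul_pos ht' (sq_pos_of_ne_zero (sub_ne_zero.mpr hij))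
  simp only [Finset.mul_sum, ← Finset.sum_add_distrib, Matrix.add_apply, Matrix.smul_apply,
    smul_eq_mul, hgap]
  simp only [Finset.sum_add_distrib]
  exact lt_add_of_pos_right _ hpos
end

section
/- Let S ⊆ ℝᵈ be an open convex set, let f_k : S → ℝ be a sequence of convex functions, and suppose f_k converges pointwise on S to a function f̄ : S → ℝ. Then for every compact subset Θ ⊆ S, sup_{θ ∈ Θ} |f_k(θ) − f̄(θ)| → 0 as k → ∞; i.e., the convergence is uniform on every compact subset of S. -/
open Filter Topology

/-- The pointwise supremum of a pointwise bounded above family of convex functions is convex. -/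
theorem ConvexOn.iSup_of_bddAbove {ι E : Type*} [Nonempty ι] [AddCommGroup E] [Module ℝ E]
    {S : Set E} {f : ι → E → ℝ} (hS : Convex ℝ S) (hf : ∀ i, ConvexOn ℝ S (f i))
    (hb : ∀ x ∈ S, BddAbove (Set.range fun i => f i x)) :
    ConvexOn ℝ S fun x => ⨆ i, f i x := by
  refine ⟨hS, fun x hx y hy a b ha hb' hab => ciSup_le fun i => ?_⟩
  refine ((hf i).2 hx hy ha hb' hab).trans ?_
  simp only [smul_eq_mul]
  gcongr
  · exact le_ciSup (hb x hx) i
  · exact le_ciSup (hb y hy) i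

/-- A pointwise bounded family of convex functions on an open subset of a finite-dimensional space
is equicontinuous at every point of that set. -/
theorem ConvexOn.equicontinuousAt_of_pointwise_bounded {ι E : Type*} [Nonempty ι]
    [NormedAddCommGroup E] [NormedSpace ℝ E] [FiniteDimensional ℝ E] {S : Set E} {f : ι → E → ℝ}
    (hS : IsOpen S) (hf : ∀ i, ConvexOn ℝ S (f i))
    (hb : ∀ x ∈ S, ∃ C, ∀ i, |f i x| ≤ C) {x : E} (hx : x ∈ S) : EquicontinuousAt f x := by
  have hbdd : ∀ y ∈ S, BddAbove (Set.range fun i => f i y) := fun y hy => by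
    obtain ⟨C, hC⟩ := hb y hy
    exact ⟨C, Set.forall_mem_range.2 fun i => (le_abs_self _).trans (hC i)⟩
  have hconv : Convex ℝ S := (hf (Classical.arbitrary ι)).1
  have hcont : ContinuousAt (fun y => ⨆ i, f i y) x :=
    ((ConvexOn.iSup_of_bddAbove hconv hf hbdd).continuousOn hS).continuousAt (hS.mem_nhds hx)
  set M := (⨆ i, f i x) + 1
  have hlt : ∀ᶠ y in 𝓝 x, ⨆ i, f i y < M := hcont.eventually_lt_const (lt_add_one _)
  obtain ⟨r, hr, hball⟩ := Metric.eventually_nhds_iff_ball.1 (hlt.and (hS.eventually_mem hx))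
  have hupper : ∀ y ∈ Metric.ball x r, ∀ i, f i y ≤ M := fun y hy i =>
    (le_ciSup (hbdd y (hball y hy).2) i).trans (hball y hy).1.le
  obtain ⟨C, hC⟩ := hb x hx
  have habs : ∀ i, ∀ y, dist y x < r → |f i y| ≤ |M| + 2 * C := by
    intro i y hy
    have hC0 := (abs_nonneg _).trans (hC i)
    have hz : (2 : ℝ) • x - y ∈ Metric.ball x r := by
      rw [mem_ball_iff_norm, show (2 : ℝ) • x - y - x = x - y by module, ← dist_eq_norm, dist_comm]
      exact hy
    have hmid := (hf i).2 (hball y hy).2 (hball _ hz).2 (by norm_num : (0 : ℝ) ≤ 1 / 2)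
      (by norm_num : (0 : ℝ) ≤ 1 / 2) (by norm_num)
    rw [show (1 / 2 : ℝ) • y + (1 / 2 : ℝ) • ((2 : ℝ) • x - y) = x by module] at hmid
    simp only [smul_eq_mul] at hmid
    have := hupper y hy i
    have := hupper _ hz i
    have := le_abs_self M
    have := (abs_le.1 (hC i)).1
    exact abs_le.2 ⟨by linarith, by linarith⟩
  have hlip : ∀ i, LipschitzOnWith (2 * (|M| + 2 * C) / (r / 2)).toNNReal (f i)
      (Metric.ball x (r - r / 2)) := fun i =>
    ((hf i).subset (fun y hy => (hball y hy).2) (convex_ball x r)).lipschitzOnWith_of_abs_le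
      (half_pos hr) (habs i)
  have hx' : Metric.ball x (r - r / 2) ∈ 𝓝 x := Metric.ball_mem_nhds x (by linarith)
  have hequi := (LipschitzOnWith.uniformEquicontinuousOn f _ hlip).equicontinuousOn x
    (mem_of_mem_nhds hx')
  intro U hU
  exact nhdsWithin_eq_nhds.2 hx' ▸ hequi U hU

/-- If a sequence of convex functions on an open convex set S ⊆ ℝᵈ
converges pointwise on S, then the convergence is uniform on every compact subset of S. -/
theorem stmt_12 (d : ℕ) (S : Set (EuclideanSpace ℝ (Fin d)))
    (hopen : IsOpen S) (hconv : Convex ℝ S)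
    (f : ℕ → EuclideanSpace ℝ (Fin d) → ℝ)
    (hfconv : ∀ k, ConvexOn ℝ S (f k))
    (fbar : EuclideanSpace ℝ (Fin d) → ℝ)
    (hpt : ∀ θ ∈ S, Tendsto (fun k => f k θ) atTop (𝓝 (fbar θ))) :
    ∀ Θ : Set (EuclideanSpace ℝ (Fin d)), Θ ⊆ S → IsCompact Θ →
      TendstoUniformlyOn f fbar atTop Θ := by
  intro Θ hΘ hcompact
  have hbounded : ∀ x ∈ S, ∃ C, ∀ k, |f k x| ≤ C := fun x hx => by
    obtain ⟨C, hC⟩ := (Metric.isBounded_range_of_tendsto _ (hpt x hx)).exists_norm_le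
    exact ⟨C, fun k => hC _ (Set.mem_range_self k)⟩
  have hequi : EquicontinuousOn f Θ := fun x hx =>
    (ConvexOn.equicontinuousAt_of_pointwise_bounded hopen hfconv hbounded
      (hΘ hx)).equicontinuousWithinAt Θ
  have htendsto := (EquicontinuousOn.tendsto_uniformOnFun_iff_pi' (𝔖 := {Θ})
    (by simpa using hcompact) (by simpa using hequi) atTop fbar).2
    (tendsto_pi_nhds.2 fun x => hpt x (hΘ (by simpa using x.2)))
  exact UniformOnFun.tendsto_iff_tendstoUniformlyOn.1 htendsto Θ rfl
end
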